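/- Let U be a finite nonempty variable set and 𝒞 a finite nonempty collection of clauses, each clause a subset of U of size at least 2, and suppose b : U → {True, False} is an NAE-assignment for (U,𝒞). Define a coloring f of G(U,𝒞) with colors {0,1,2} by: f(v) = 1 if b(v) = True and f(v) = 0 if b(v) = False for each variable vertex v ∈ U; f(c) = 2 for every clause vertex c ∈ 𝒞; f(h_i) = 2 for 1 ≤ i ≤ 7; f(a_i) = 0 and f(b_i) = 1 for 1 ≤ i ≤ 7. Then f is a strong conflict-free vertex-connection 3-coloring of G(U,𝒞). -/

import Mathlib

/-- The vertex type of the gadget graph `G(U, 𝒞)`: a vertex for each variable in `U`,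
a vertex for each clause in `C`, and 21 extra vertices `a_1, ..., a_7`,
`b_1, ..., b_7`, `h_1, ..., h_7` (indexed here by `Fin 7`, so `A 0` is `a_1`, etc.). -/
inductive GV (U C : Type) : Type
  | var : U → GV U C
  | cls : C → GV U C
  | A : Fin 7 → GV U C
  | B : Fin 7 → GV U C
  | H : Fin 7 → GV U C

/-- The edges of the gadget graph `G(U, 𝒞)` (given as a relation, to be
symmetrized): `h_i a_i`, `a_i h_{i+1}`, `h_{i+1} b_i`, `b_i h_i` for `1 ≤ i ≤ 6`;
`h_7 a_7` and `h_7 b_7`; an edge between clause vertex `c` and variable vertex `v`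
whenever `v ∈ c`; edges `a_7 c` and `b_7 c` for every clause `c ∈ 𝒞`; and edges
`h_1 v` for every variable `v ∈ U`. -/
def gadgetRel {U : Type} (𝒞 : Finset (Finset U)) :
    GV U {C : Finset U // C ∈ 𝒞} → GV U {C : Finset U // C ∈ 𝒞} → Prop
  | .H i, .A j => i = j ∨ i.val = j.val + 1
  | .H i, .B j => i = j ∨ i.val = j.val + 1
  | .cls c, .var v => v ∈ c.val
  | .A i, .cls _ => i.val = 6
  | .B i, .cls _ => i.val = 6
  | .H i, .var _ => i.val = 0
  | _, _ => False

/-- The gadget graph `G(U, 𝒞)` of the reduction from positive NAE-SAT. -/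
def gadgetGraph {U : Type} (𝒞 : Finset (Finset U)) :
    SimpleGraph (GV U {C : Finset U // C ∈ 𝒞}) :=
  SimpleGraph.fromRel (gadgetRel 𝒞)

/-- A walk in a vertex-colored graph is conflict-free if some color appears on
exactly one vertex of the walk. -/
def ConflictFree {V α : Type*} {G : SimpleGraph V} (f : V → α) {u v : V}
    (p : G.Walk u v) : Prop :=
  ∃ c : α, ∃! x, x ∈ p.support ∧ f x = c

/-- A coloring `f` is a strong conflict-free vertex-connection coloring if every two
distinct vertices are joined by a conflict-free shortest path. -/
def IsStrongCfvc {V α : Type*} (G : SimpleGraph V) (f : V → α) : Prop :=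
  ∀ u v : V, u ≠ v →
    ∃ p : G.Walk u v, p.IsPath ∧ p.length = G.dist u v ∧ ConflictFree f p

/-- The coloring of the gadget graph obtained from a truth assignment `b`:
variable vertices get color 1 if true and 0 if false, clause vertices and the `h_i`
get color 2, the `a_i` get color 0 and the `b_i` get color 1. -/
def naeColoring {U C : Type} (b : U → Bool) : GV U C → Fin 3
  | .var v => if b v then 1 else 0
  | .cls _ => 2
  | .H _ => 2
  | .A _ => 0
  | .B _ => 1

/-- `HasWalk G f u v n k l` says that some `u,v`-walk of length `n` has `k` vertices of color `0`
and `l` vertices of color `1`, counted with multiplicity. -/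
def HasWalk {V : Type*} (G : SimpleGraph V) (f : V → Fin 3) (u v : V) (n k l : ℕ) : Prop :=
  ∃ p : G.Walk u v, p.length = n ∧ (p.support.map f).count 0 = k ∧ (p.support.map f).count 1 = l

/-- Some shortest `u,v`-path is conflict-free. -/
def HasConflictFreeGeodesic {V : Type*} (G : SimpleGraph V) (f : V → Fin 3) (u v : V) : Prop :=
  ∃ p : G.Walk u v, p.IsPath ∧ p.length = G.dist u v ∧ ConflictFree f p

section Walks

variable {V : Type*} {G : SimpleGraph V} {f : V → Fin 3} {u v w : V} {n k l : ℕ}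

theorem HasWalk.symm (h : HasWalk G f u v n k l) : HasWalk G f v u n k l := by
  obtain ⟨p, h₁, h₂, h₃⟩ := h
  refine ⟨p.reverse, by simpa using h₁, ?_, ?_⟩ <;>
    simpa [SimpleGraph.Walk.support_reverse, List.map_reverse]

theorem HasWalk.cons (huw : G.Adj u w) (h : HasWalk G f w v n k l) :
    HasWalk G f u v (n + 1) (k + if f u = 0 then 1 else 0) (l + if f u = 1 then 1 else 0) := by
  obtain ⟨p, rfl, rfl, rfl⟩ := h
  refine ⟨.cons huw p, by simp, ?_, ?_⟩ <;> simp [List.count_cons]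

theorem HasWalk.concat (h : HasWalk G f u w n k l) (hwv : G.Adj v w) :
    HasWalk G f u v (n + 1) (k + if f v = 0 then 1 else 0) (l + if f v = 1 then 1 else 0) :=
  (h.symm.cons hwv).symm

theorem HasConflictFreeGeodesic.symm (h : HasConflictFreeGeodesic G f u v) :
    HasConflictFreeGeodesic G f v u := by
  obtain ⟨p, hp, hd, c, hc⟩ := h
  refine ⟨p.reverse, hp.reverse, by rw [SimpleGraph.Walk.length_reverse, hd, G.dist_comm], c, ?_⟩
  simpa [SimpleGraph.Walk.support_reverse] using hc

theorem existsUnique_of_count_map_eq_one {α β : Type*} [DecidableEq β] (g : α → β) (c : β) :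
    ∀ s : List α, (s.map g).count c = 1 → ∃! x, x ∈ s ∧ g x = c
  | [], h => by simp at h
  | a :: s, h => by
    by_cases ha : g a = c
    · have h₀ : (s.map g).count c = 0 := by simpa [List.count_cons, ha] using h
      refine ⟨a, by simp [ha], fun y hy => ?_⟩
      rcases List.mem_cons.1 hy.1 with rfl | hys
      · rfl
      · exact absurd (hy.2 ▸ List.mem_map_of_mem hys) (List.count_eq_zero.1 h₀)
    · have h₁ : (s.map g).count c = 1 := by simpa [List.count_cons, ha] using h
      obtain ⟨x, hx, hu⟩ := existsUnique_of_count_map_eq_one g c s h₁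
      refine ⟨x, ⟨List.mem_cons_of_mem _ hx.1, hx.2⟩, fun y hy => hu y ⟨?_, hy.2⟩⟩
      rcases List.mem_cons.1 hy.1 with rfl | hys
      · exact absurd hy.2 ha
      · exact hys

theorem count_add_count_add_count_eq_length (s : List (Fin 3)) :
    s.count 0 + s.count 1 + s.count 2 = s.length := by
  induction s with
  | nil => rfl
  | cons a s ih => fin_cases a <;> simp <;> omega

/-- A color is unique on a walk with color counts `k`, `l` and `n + 1 - k - l` as soon as one of
these numbers is `1`. -/
theorem HasWalk.hasConflictFreeGeodesic (h : HasWalk G f u v n k l)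
    (hmin : ∀ p : G.Walk u v, n ≤ p.length) (hc : k = 1 ∨ l = 1 ∨ n = k + l) :
    HasConflictFreeGeodesic G f u v := by
  obtain ⟨p, rfl, rfl, rfl⟩ := h
  obtain ⟨q, hq⟩ := p.reachable.exists_walk_length_eq_dist
  have hd : p.length = G.dist u v := le_antisymm (hq ▸ hmin q) (G.dist_le p)
  refine ⟨p, p.isPath_of_length_eq_dist hd, hd, ?_⟩
  have hcount := count_add_count_add_count_eq_length (p.support.map f)
  rw [List.length_map, SimpleGraph.Walk.length_support] at hcount
  rcases hc with hc | hc | hc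
  · exact ⟨0, existsUnique_of_count_map_eq_one f 0 _ hc⟩
  · exact ⟨1, existsUnique_of_count_map_eq_one f 1 _ hc⟩
  · exact ⟨2, existsUnique_of_count_map_eq_one f 2 _ (by omega)⟩

theorem SimpleGraph.Walk.le_add_length_of_lipschitz {φ : V → ℕ}
    (hφ : ∀ x y, G.Adj x y → φ y ≤ φ x + 1) (p : G.Walk u v) : φ v ≤ φ u + p.length := by
  induction p with
  | nil => simp
  | cons h p ih =>
    have := hφ _ _ h
    rw [SimpleGraph.Walk.length_cons]
    omega

end Walks

section Gadget

variable {U : Type} {𝒞 : Finset (Finset U)}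

/-- The position of a vertex on the cycle of length `16` onto which the gadget graph folds. -/
def GV.level {U C : Type} : GV U C → ℕ
  | .var _ => 15
  | .cls _ => 14
  | .A i => 2 * i.val + 1
  | .B i => 2 * i.val + 1
  | .H i => 2 * i.val

/-- The vertices of even level, listed cyclically, with `c` as the only clause vertex. -/
def GV.even {U C : Type} (c : C) (k : ℕ) : GV U C :=
  if h : k % 8 < 7 then .H ⟨k % 8, h⟩ else .cls c

/-- The vertices `a_i` (for `x = false`) and `b_i` (for `x = true`). -/
def GV.side {U C : Type} (x : Bool) (i : Fin 7) : GV U C :=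
  if x then .B i else .A i

/-- The color that stands for a truth value. -/
def boolColor (x : Bool) : Fin 3 := if x then 1 else 0

theorem GV.even_add_eight {U C : Type} (c : C) (k : ℕ) :
    (GV.even c (k + 8) : GV U C) = GV.even c k := by
  simp [GV.even]

theorem GV.even_val {U C : Type} (c : C) (i : Fin 7) : (GV.even c i.val : GV U C) = .H i := by
  have := i.isLt
  have h : i.val % 8 = i.val := by omega
  simp [GV.even, h]

theorem GV.even_seven {U C : Type} (c : C) : (GV.even c 7 : GV U C) = .cls c := rfl

theorem GV.level_even {U C : Type} (c : C) {k : ℕ} (hk : k < 8) :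
    (GV.even c k : GV U C).level = 2 * k := by
  have h : k % 8 = k := Nat.mod_eq_of_lt hk
  by_cases h7 : k < 7
  · simp [GV.even, h, h7, GV.level]
  · obtain rfl : k = 7 := by omega
    rfl

theorem GV.level_side {U C : Type} (x : Bool) (i : Fin 7) :
    (GV.side x i : GV U C).level = 2 * i.val + 1 := by
  cases x <;> rfl

theorem naeColoring_even {C : Type} (b : U → Bool) (c : C) (k : ℕ) :
    naeColoring b (GV.even c k) = 2 := by
  unfold GV.even
  split_ifs <;> rfl

theorem naeColoring_side {C : Type} (b : U → Bool) (x : Bool) (i : Fin 7) :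
    naeColoring b (GV.side x i : GV U C) = boolColor x := by
  cases x <;> rfl

theorem adj_side_even (c : {C : Finset U // C ∈ 𝒞}) (x : Bool) (i : Fin 7) :
    (gadgetGraph 𝒞).Adj (GV.side x i) (GV.even c i) := by
  rw [GV.even_val]
  cases x <;> simp [gadgetGraph, gadgetRel, GV.side]

theorem adj_side_even_succ (c : {C : Finset U // C ∈ 𝒞}) (x : Bool) (i : Fin 7) :
    (gadgetGraph 𝒞).Adj (GV.side x i) (GV.even c (i + 1)) := by
  have := i.isLt
  by_cases hi : i.val = 6
  · rw [hi, GV.even_seven]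
    cases x <;> simp [gadgetGraph, gadgetRel, GV.side, hi]
  · have h : (i.val + 1) % 8 = i.val + 1 := by omega
    have h' : i.val + 1 < 7 := by omega
    cases x <;> simp [gadgetGraph, gadgetRel, GV.side, GV.even, h, h']

theorem adj_var_H_zero (v : U) : (gadgetGraph 𝒞).Adj (.var v) (.H 0) := by
  simp [gadgetGraph, gadgetRel]

theorem adj_var_cls {c : {C : Finset U // C ∈ 𝒞}} {v : U} (h : v ∈ c.val) :
    (gadgetGraph 𝒞).Adj (.var v) (.cls c) := by
  simpa [gadgetGraph, gadgetRel] using h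

theorem level_of_adj {x y : GV U {C : Finset U // C ∈ 𝒞}} (h : (gadgetGraph 𝒞).Adj x y) :
    x.level + 1 = y.level ∨ y.level + 1 = x.level ∨ (x.level = 0 ∧ y.level = 15) ∨
      (x.level = 15 ∧ y.level = 0) := by
  cases x <;> cases y <;> simp [gadgetGraph, gadgetRel, GV.level, Fin.ext_iff, -Fin.val_eq_zero_iff] at h ⊢ <;> omega

theorem GV.level_lt {C : Type} (x : GV U C) : x.level < 16 := by
  cases x <;> simp only [GV.level] <;> omega

/-- Every walk is at least as long as the cyclic distance between the levels of its ends. -/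
theorem le_length_of_level {u v : GV U {C : Finset U // C ∈ 𝒞}} {n : ℕ}
    (h₁ : n + u.level ≤ v.level ∨ n + v.level ≤ u.level)
    (h₂ : n + v.level ≤ 16 + u.level) (h₃ : n + u.level ≤ 16 + v.level)
    (p : (gadgetGraph 𝒞).Walk u v) : n ≤ p.length := by
  have hp := p.le_add_length_of_lipschitz (φ := fun w =>
    min ((w.level - u.level) + (u.level - w.level))
      (16 - ((w.level - u.level) + (u.level - w.level)))) fun x y hxy => by
    have := level_of_adj hxy
    have := x.level_lt
    have := y.level_lt
    have := u.level_lt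
    omega
  omega

theorem two_le_length_of_level_eq {u v : GV U {C : Finset U // C ∈ 𝒞}} (huv : u ≠ v)
    (h : u.level = v.level) (p : (gadgetGraph 𝒞).Walk u v) : 2 ≤ p.length := by
  cases p with
  | nil => exact absurd rfl huv
  | cons h₁ p =>
    cases p with
    | nil =>
      have := level_of_adj h₁
      omega
    | cons h₂ p => simp

open Classical in
/-- The distance in the gadget graph from the vertex of the variable `v`, capped above by the
length of the way through `h_1`. -/
noncomputable def varPotential (v : U) : GV U {C : Finset U // C ∈ 𝒞} → ℕ
  | .var w => if w = v then 0 else 2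
  | .cls c => if v ∈ c.val then 1 else 3
  | w => min (w.level + 1) (if ∃ C ∈ 𝒞, v ∈ C then 15 - w.level else 17 - w.level)

theorem varPotential_lipschitz (v : U) (x y : GV U {C : Finset U // C ∈ 𝒞})
    (h : (gadgetGraph 𝒞).Adj x y) : varPotential v y ≤ varPotential v x + 1 := by
  by_cases hv : ∃ C ∈ 𝒞, v ∈ C
  · cases x <;> cases y <;>
      simp [gadgetGraph, gadgetRel, GV.level, varPotential, Fin.ext_iff,
        -Fin.val_eq_zero_iff, if_pos hv] at h ⊢ <;>
      (try split_ifs) <;> (try subst_vars) <;> first | omega | simp_all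
  · have hv' : ∀ c : {C : Finset U // C ∈ 𝒞}, v ∉ c.val := fun c hc => hv ⟨c.1, c.2, hc⟩
    cases x <;> cases y <;>
      simp [gadgetGraph, gadgetRel, GV.level, varPotential, Fin.ext_iff,
        -Fin.val_eq_zero_iff, if_neg hv, hv'] at h ⊢ <;>
      (try split_ifs) <;> (try subst_vars) <;> first | omega | simp_all

theorem varPotential_le_length {v : U} {w : GV U {C : Finset U // C ∈ 𝒞}}
    (p : (gadgetGraph 𝒞).Walk (.var v) w) : varPotential v w ≤ p.length := by
  simpa [varPotential] using p.le_add_length_of_lipschitz (varPotential_lipschitz v)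

theorem GV.even_mod_eight {C : Type} (c : C) (k : ℕ) :
    (GV.even c (k % 8) : GV U C) = GV.even c k := by
  simp [GV.even]

theorem exists_adj_even_adj_even_succ {b : U → Bool}
    (hnae : ∀ C ∈ 𝒞, (∃ x ∈ C, b x = true) ∧ (∃ y ∈ C, b y = false))
    (c : {C : Finset U // C ∈ 𝒞}) (k : ℕ) (x : Bool) :
    ∃ w, (gadgetGraph 𝒞).Adj (GV.even c k) w ∧ (gadgetGraph 𝒞).Adj w (GV.even c (k + 1)) ∧
      naeColoring b w = boolColor x := by
  have hk : (GV.even c (k + 1) : GV U _) = GV.even c (k % 8 + 1) := by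
    rw [← GV.even_mod_eight, ← GV.even_mod_eight c (k % 8 + 1)]
    simp
  rw [hk, ← GV.even_mod_eight c k]
  by_cases h : k % 8 < 7
  · exact ⟨_, (adj_side_even c x ⟨k % 8, h⟩).symm, adj_side_even_succ c x ⟨k % 8, h⟩,
      naeColoring_side b x _⟩
  · have h7 : k % 8 = 7 := by omega
    obtain ⟨v, hv, hb⟩ : ∃ v ∈ c.val, b v = x := by
      cases x
      exacts [(hnae c.1 c.2).2, (hnae c.1 c.2).1]
    rw [h7]
    exact ⟨.var v, (adj_var_cls hv).symm, adj_var_H_zero v, by simp [naeColoring, boolColor, hb]⟩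

theorem hasWalk_even_add {b : U → Bool}
    (hnae : ∀ C ∈ 𝒞, (∃ x ∈ C, b x = true) ∧ (∃ y ∈ C, b y = false))
    (c : {C : Finset U // C ∈ 𝒞}) (i n k l : ℕ) (h : k + l = n) :
    HasWalk (gadgetGraph 𝒞) (naeColoring b) (GV.even c i) (GV.even c (i + n)) (2 * n) k l := by
  induction n generalizing i k l with
  | zero =>
    obtain ⟨rfl, rfl⟩ : k = 0 ∧ l = 0 := by omega
    exact ⟨.nil, by simp [naeColoring_even]⟩
  | succ n ih =>
    have hi : i + (n + 1) = i + 1 + n := by omega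
    rw [hi]
    rcases Nat.eq_zero_or_pos k with rfl | hk
    · obtain ⟨w, h₁, h₂, hw⟩ := exists_adj_even_adj_even_succ hnae c i true
      simpa [naeColoring_even, hw, boolColor, Nat.mul_succ, show l - 1 + 1 = l by omega] using
        ((ih (i + 1) 0 (l - 1) (by omega)).cons h₂).cons h₁
    · obtain ⟨w, h₁, h₂, hw⟩ := exists_adj_even_adj_even_succ hnae c i false
      simpa [naeColoring_even, hw, boolColor, Nat.mul_succ, show k - 1 + 1 = k by omega] using
        ((ih (i + 1) (k - 1) l (by omega)).cons h₂).cons h₁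

theorem hasWalk_even_even {b : U → Bool}
    (hnae : ∀ C ∈ 𝒞, (∃ x ∈ C, b x = true) ∧ (∃ y ∈ C, b y = false))
    (c : {C : Finset U // C ∈ 𝒞}) (i j k l : ℕ) (h : k + l = (i - j) + (j - i)) :
    HasWalk (gadgetGraph 𝒞) (naeColoring b) (GV.even c i) (GV.even c j) (2 * (k + l)) k l := by
  rcases le_total i j with hij | hij
  · have := hasWalk_even_add hnae c i (k + l) k l rfl
    rwa [show i + (k + l) = j by omega] at this
  · have := hasWalk_even_add hnae c j (k + l) k l rfl
    rw [show j + (k + l) = i by omega] at this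
    exact this.symm

theorem hasConflictFreeGeodesic_even_even {b : U → Bool}
    (hnae : ∀ C ∈ 𝒞, (∃ x ∈ C, b x = true) ∧ (∃ y ∈ C, b y = false))
    (c : {C : Finset U // C ∈ 𝒞}) (i j : ℕ) {u v : GV U {C : Finset U // C ∈ 𝒞}}
    (hu : u = GV.even c i) (hv : v = GV.even c j) (hij : i ≠ j)
    (hmin : ∀ p : (gadgetGraph 𝒞).Walk u v, 2 * ((i - j) + (j - i)) ≤ p.length) :
    HasConflictFreeGeodesic (gadgetGraph 𝒞) (naeColoring b) u v := by
  subst hu hv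
  exact (hasWalk_even_even hnae c i j 1 ((i - j) + (j - i) - 1) (by omega)).hasConflictFreeGeodesic
    (fun p => by have := hmin p; omega) (by simp)

theorem hasConflictFreeGeodesic_odd_even {b : U → Bool}
    (hnae : ∀ C ∈ 𝒞, (∃ x ∈ C, b x = true) ∧ (∃ y ∈ C, b y = false))
    (c : {C : Finset U // C ∈ 𝒞}) (i j : ℕ) {u v : GV U {C : Finset U // C ∈ 𝒞}} {x : Bool}
    (hx : naeColoring b u = boolColor x) (hu : (gadgetGraph 𝒞).Adj u (GV.even c i))
    (hv : v = GV.even c j)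
    (hmin : ∀ p : (gadgetGraph 𝒞).Walk u v, 2 * ((i - j) + (j - i)) + 1 ≤ p.length) :
    HasConflictFreeGeodesic (gadgetGraph 𝒞) (naeColoring b) u v := by
  subst hv
  cases x
  · exact ((hasWalk_even_even hnae c i j 0 _ (Nat.zero_add _)).cons hu).hasConflictFreeGeodesic
      (fun p => by have := hmin p; omega) (by simp [hx, boolColor])
  · exact ((hasWalk_even_even hnae c i j _ 0 (Nat.add_zero _)).cons hu).hasConflictFreeGeodesic
      (fun p => by have := hmin p; omega) (by simp [hx, boolColor])

theorem hasConflictFreeGeodesic_odd_odd {b : U → Bool}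
    (hnae : ∀ C ∈ 𝒞, (∃ x ∈ C, b x = true) ∧ (∃ y ∈ C, b y = false))
    (c : {C : Finset U // C ∈ 𝒞}) (i j : ℕ) {u v : GV U {C : Finset U // C ∈ 𝒞}} {x y : Bool}
    (hx : naeColoring b u = boolColor x) (hy : naeColoring b v = boolColor y)
    (hu : (gadgetGraph 𝒞).Adj u (GV.even c i)) (hv : (gadgetGraph 𝒞).Adj v (GV.even c j))
    (hmin : ∀ p : (gadgetGraph 𝒞).Walk u v, 2 * ((i - j) + (j - i)) + 2 ≤ p.length) :
    HasConflictFreeGeodesic (gadgetGraph 𝒞) (naeColoring b) u v := by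
  have key (k l : ℕ) (h : k + l = (i - j) + (j - i)) :=
    (((hasWalk_even_even hnae c i j k l h).cons hu).concat hv).hasConflictFreeGeodesic
      (fun p => by have := hmin p; omega)
  generalize (i - j) + (j - i) = d at key
  cases x <;> cases y <;> simp only [hx, hy, boolColor] at key
  · cases d with
    | zero => exact key 0 0 rfl (by simp)
    | succ d => exact key d 1 rfl (by simp)
  · exact key 0 d (by simp) (by simp)
  · exact key d 0 (by simp) (by simp)
  · cases d with
    | zero => exact key 0 0 rfl (by simp)
    | succ d => exact key 1 d (by omega) (by simp)

theorem hasConflictFreeGeodesic_even_even_of_lt {b : U → Bool}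
    (hnae : ∀ C ∈ 𝒞, (∃ x ∈ C, b x = true) ∧ (∃ y ∈ C, b y = false))
    (c : {C : Finset U // C ∈ 𝒞}) {i j : ℕ} (hi : i < 8) (hj : j < 8) (hij : i ≠ j) :
    HasConflictFreeGeodesic (gadgetGraph 𝒞) (naeColoring b) (GV.even c i) (GV.even c j) := by
  wlog h : i < j generalizing i j
  · exact (this hj hi hij.symm (by omega)).symm
  have hli := GV.level_even (U := U) c hi
  have hlj := GV.level_even (U := U) c hj
  by_cases h4 : j - i ≤ 4
  · exact hasConflictFreeGeodesic_even_even hnae c i j rfl rfl hij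
      (le_length_of_level (by omega) (by omega) (by omega))
  · exact hasConflictFreeGeodesic_even_even hnae c (i + 8) j (GV.even_add_eight c i).symm rfl
      (by omega) (le_length_of_level (by omega) (by omega) (by omega))

theorem hasConflictFreeGeodesic_side_even {b : U → Bool}
    (hnae : ∀ C ∈ 𝒞, (∃ x ∈ C, b x = true) ∧ (∃ y ∈ C, b y = false))
    (c : {C : Finset U // C ∈ 𝒞}) (x : Bool) (i : Fin 7) {j : ℕ} (hj : j < 8) :
    HasConflictFreeGeodesic (gadgetGraph 𝒞) (naeColoring b) (GV.side x i) (GV.even c j) := by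
  have hli := GV.level_side (U := U) (C := {C : Finset U // C ∈ 𝒞}) x i
  have hlj := GV.level_even (U := U) c hj
  have hx := naeColoring_side (C := {C : Finset U // C ∈ 𝒞}) b x i
  have hi := i.isLt
  have h₀ := adj_side_even c x i
  have h₁ := adj_side_even_succ c x i
  by_cases hij : j ≤ i
  · by_cases h4 : i.val - j < 4
    · exact hasConflictFreeGeodesic_odd_even hnae c i j hx h₀ rfl
        (le_length_of_level (by omega) (by omega) (by omega))
    · exact hasConflictFreeGeodesic_odd_even hnae c (i + 1) (j + 8) hx h₁
        (GV.even_add_eight c j).symm (le_length_of_level (by omega) (by omega) (by omega))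
  · by_cases h4 : j - i.val ≤ 4
    · exact hasConflictFreeGeodesic_odd_even hnae c (i + 1) j hx h₁ rfl
        (le_length_of_level (by omega) (by omega) (by omega))
    · rw [← GV.even_add_eight] at h₀
      exact hasConflictFreeGeodesic_odd_even hnae c (i + 8) j hx h₀ rfl
        (le_length_of_level (by omega) (by omega) (by omega))

theorem hasConflictFreeGeodesic_side_side {b : U → Bool}
    (hnae : ∀ C ∈ 𝒞, (∃ x ∈ C, b x = true) ∧ (∃ y ∈ C, b y = false))
    (c : {C : Finset U // C ∈ 𝒞}) (x y : Bool) (i j : Fin 7)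
    (hne : (GV.side x i : GV U {C : Finset U // C ∈ 𝒞}) ≠ GV.side y j) :
    HasConflictFreeGeodesic (gadgetGraph 𝒞) (naeColoring b) (GV.side x i) (GV.side y j) := by
  wlog h : i ≤ j generalizing i j x y
  · exact (this y x j i hne.symm (le_of_not_ge h)).symm
  have hli := GV.level_side (U := U) (C := {C : Finset U // C ∈ 𝒞}) x i
  have hlj := GV.level_side (U := U) (C := {C : Finset U // C ∈ 𝒞}) y j
  have hx := naeColoring_side (C := {C : Finset U // C ∈ 𝒞}) b x i
  have hy := naeColoring_side (C := {C : Finset U // C ∈ 𝒞}) b y j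
  rcases h.eq_or_lt with rfl | h
  · exact hasConflictFreeGeodesic_odd_odd hnae c i i hx hy (adj_side_even c x i)
      (adj_side_even c y i) fun p => by
        have := two_le_length_of_level_eq hne (by omega) p
        omega
  · rw [Fin.lt_def] at h
    by_cases h4 : j.val - i ≤ 4
    · exact hasConflictFreeGeodesic_odd_odd hnae c (i + 1) j hx hy (adj_side_even_succ c x i)
        (adj_side_even c y j) (le_length_of_level (by omega) (by omega) (by omega))
    · have h₀ := adj_side_even c x i
      rw [← GV.even_add_eight] at h₀
      exact hasConflictFreeGeodesic_odd_odd hnae c (i + 8) (j + 1) hx hy h₀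
        (adj_side_even_succ c y j) (le_length_of_level (by omega) (by omega) (by omega))

theorem naeColoring_var {C : Type} (b : U → Bool) (v : U) :
    naeColoring b (.var v : GV U C) = boolColor (b v) := rfl

theorem hasConflictFreeGeodesic_var_H {b : U → Bool}
    (hnae : ∀ C ∈ 𝒞, (∃ x ∈ C, b x = true) ∧ (∃ y ∈ C, b y = false))
    (c₀ : {C : Finset U // C ∈ 𝒞}) (v : U) (i : Fin 7) :
    HasConflictFreeGeodesic (gadgetGraph 𝒞) (naeColoring b) (.var v) (.H i) := by
  have hx := naeColoring_var (C := {C : Finset U // C ∈ 𝒞}) b v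
  have hi := i.isLt
  have hp (p : (gadgetGraph 𝒞).Walk (.var v) (.H i)) := varPotential_le_length p
  simp only [varPotential, GV.level] at hp
  by_cases hv : ∃ C ∈ 𝒞, v ∈ C
  · obtain ⟨C, hC, hvC⟩ := id hv
    simp only [if_pos hv] at hp
    by_cases h : i.val ≤ 3
    · exact hasConflictFreeGeodesic_odd_even hnae c₀ 0 i hx (adj_var_H_zero v)
        (GV.even_val c₀ i).symm fun p => by have := hp p; omega
    · exact hasConflictFreeGeodesic_odd_even hnae ⟨C, hC⟩ 7 i hx (adj_var_cls hvC)
        (GV.even_val _ i).symm fun p => by have := hp p; omega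
  · simp only [if_neg hv] at hp
    by_cases h : i.val ≤ 3
    · exact hasConflictFreeGeodesic_odd_even hnae c₀ 0 i hx (adj_var_H_zero v)
        (GV.even_val c₀ i).symm fun p => by have := hp p; omega
    · exact hasConflictFreeGeodesic_odd_even hnae c₀ 8 i hx (adj_var_H_zero v)
        (GV.even_val c₀ i).symm fun p => by have := hp p; omega

open Classical in
theorem hasConflictFreeGeodesic_var_side {b : U → Bool}
    (hnae : ∀ C ∈ 𝒞, (∃ x ∈ C, b x = true) ∧ (∃ y ∈ C, b y = false))
    (c₀ : {C : Finset U // C ∈ 𝒞}) (v : U) (y : Bool) (i : Fin 7) :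
    HasConflictFreeGeodesic (gadgetGraph 𝒞) (naeColoring b) (.var v) (GV.side y i) := by
  have hx := naeColoring_var (C := {C : Finset U // C ∈ 𝒞}) b v
  have hy := naeColoring_side (C := {C : Finset U // C ∈ 𝒞}) b y i
  have hi := i.isLt
  have hp (p : (gadgetGraph 𝒞).Walk (.var v) (GV.side y i)) :
      min (2 * i.val + 1 + 1)
        (if ∃ C ∈ 𝒞, v ∈ C then 15 - (2 * i.val + 1) else 17 - (2 * i.val + 1)) ≤ p.length := by
    have := varPotential_le_length p
    cases y <;> exact this
  by_cases hv : ∃ C ∈ 𝒞, v ∈ C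
  · obtain ⟨C, hC, hvC⟩ := id hv
    simp only [if_pos hv] at hp
    by_cases h : i.val ≤ 3
    · exact hasConflictFreeGeodesic_odd_odd hnae c₀ 0 i hx hy (adj_var_H_zero v)
        (adj_side_even c₀ y i) fun p => by have := hp p; omega
    · exact hasConflictFreeGeodesic_odd_odd hnae ⟨C, hC⟩ 7 (i + 1) hx hy (adj_var_cls hvC)
        (adj_side_even_succ _ y i) fun p => by have := hp p; omega
  · simp only [if_neg hv] at hp
    by_cases h : i.val ≤ 3
    · exact hasConflictFreeGeodesic_odd_odd hnae c₀ 0 i hx hy (adj_var_H_zero v)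
        (adj_side_even c₀ y i) fun p => by have := hp p; omega
    · exact hasConflictFreeGeodesic_odd_odd hnae c₀ 8 (i + 1) hx hy (adj_var_H_zero v)
        (adj_side_even_succ c₀ y i) fun p => by have := hp p; omega

theorem hasConflictFreeGeodesic_var_cls {b : U → Bool}
    (hnae : ∀ C ∈ 𝒞, (∃ x ∈ C, b x = true) ∧ (∃ y ∈ C, b y = false))
    (v : U) (c : {C : Finset U // C ∈ 𝒞}) :
    HasConflictFreeGeodesic (gadgetGraph 𝒞) (naeColoring b) (.var v) (.cls c) := by
  have hx := naeColoring_var (C := {C : Finset U // C ∈ 𝒞}) b v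
  have hp (p : (gadgetGraph 𝒞).Walk (.var v) (.cls c)) := varPotential_le_length p
  simp only [varPotential] at hp
  by_cases hv : v ∈ c.val
  · exact hasConflictFreeGeodesic_odd_even hnae c 7 7 hx (adj_var_cls hv) rfl fun p => by
      simpa [hv] using hp p
  · exact hasConflictFreeGeodesic_odd_even hnae c 8 7 hx (adj_var_H_zero v) rfl fun p => by
      simpa [hv] using hp p

theorem hasConflictFreeGeodesic_var_var {b : U → Bool}
    (hnae : ∀ C ∈ 𝒞, (∃ x ∈ C, b x = true) ∧ (∃ y ∈ C, b y = false))
    (c₀ : {C : Finset U // C ∈ 𝒞}) {v w : U} (hvw : v ≠ w) :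
    HasConflictFreeGeodesic (gadgetGraph 𝒞) (naeColoring b) (.var v) (.var w) :=
  hasConflictFreeGeodesic_odd_odd hnae c₀ 0 0 (naeColoring_var b v) (naeColoring_var b w)
    (adj_var_H_zero v) (adj_var_H_zero w)
    (two_le_length_of_level_eq (by simpa using hvw) rfl)

theorem hasConflictFreeGeodesic_cls_cls (b : U → Bool) {c d : {C : Finset U // C ∈ 𝒞}}
    (hcd : c ≠ d) :
    HasConflictFreeGeodesic (gadgetGraph 𝒞) (naeColoring b) (.cls c) (.cls d) := by
  have hc : (gadgetGraph 𝒞).Adj (.cls c) (.A 6) := by simp [gadgetGraph, gadgetRel]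
  have hd : (gadgetGraph 𝒞).Adj (.A 6) (.cls d) := by simp [gadgetGraph, gadgetRel]
  have h : HasWalk (gadgetGraph 𝒞) (naeColoring b) (.cls c) (.cls d) 2 1 0 :=
    ⟨.cons hc (.cons hd .nil), by simp [naeColoring]⟩
  exact h.hasConflictFreeGeodesic (two_le_length_of_level_eq (by simpa using hcd) rfl) (by simp)

theorem GV.cases_side_even {C : Type} (c₀ : C) (u : GV U C) :
    (∃ v, u = .var v) ∨ (∃ x i, u = GV.side x i) ∨ (∃ c, u = .cls c) ∨
      ∃ i : Fin 7, u = GV.even c₀ i.val := by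
  cases u with
  | var v => exact .inl ⟨v, rfl⟩
  | cls c => exact .inr (.inr (.inl ⟨c, rfl⟩))
  | A i => exact .inr (.inl ⟨false, i, rfl⟩)
  | B i => exact .inr (.inl ⟨true, i, rfl⟩)
  | H i => exact .inr (.inr (.inr ⟨i, (GV.even_val c₀ i).symm⟩))

end Gadget

/-- if `b` is an NAE-assignment for `(U, 𝒞)`, then the coloring
`naeColoring b` is a strong conflict-free vertex-connection 3-coloring of the gadget
graph `G(U, 𝒞)`. -/
theorem naeColoring_isStrongCfvc {U : Type} [Fintype U] [Nonempty U]
    (𝒞 : Finset (Finset U)) (h𝒞 : ∀ C ∈ 𝒞, 2 ≤ C.card) (h𝒞ne : 𝒞.Nonempty)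
    (b : U → Bool)
    (hnae : ∀ C ∈ 𝒞, (∃ x ∈ C, b x = true) ∧ (∃ y ∈ C, b y = false)) :
    IsStrongCfvc (gadgetGraph 𝒞) (naeColoring b) := by
  obtain ⟨C₀, hC₀⟩ := h𝒞ne
  let c₀ : {C : Finset U // C ∈ 𝒞} := ⟨C₀, hC₀⟩
  have var_any (v : U) (w : GV U {C : Finset U // C ∈ 𝒞}) (h : .var v ≠ w) :
      HasConflictFreeGeodesic (gadgetGraph 𝒞) (naeColoring b) (.var v) w := by
    rcases w.cases_side_even c₀ with ⟨w, rfl⟩ | ⟨x, i, rfl⟩ | ⟨c, rfl⟩ | ⟨i, rfl⟩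
    · exact hasConflictFreeGeodesic_var_var hnae c₀ (by simpa using h)
    · exact hasConflictFreeGeodesic_var_side hnae c₀ v x i
    · exact hasConflictFreeGeodesic_var_cls hnae v c
    · exact GV.even_val (U := U) c₀ i ▸ hasConflictFreeGeodesic_var_H hnae c₀ v i
  intro u w huw
  change HasConflictFreeGeodesic (gadgetGraph 𝒞) (naeColoring b) u w
  rcases u.cases_side_even c₀ with ⟨v, rfl⟩ | ⟨x, i, rfl⟩ | ⟨c, rfl⟩ | ⟨i, rfl⟩
  · exact var_any v w huw
  · rcases w.cases_side_even c₀ with ⟨w, rfl⟩ | ⟨y, j, rfl⟩ | ⟨d, rfl⟩ | ⟨j, rfl⟩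
    · exact (var_any w _ huw.symm).symm
    · exact hasConflictFreeGeodesic_side_side hnae c₀ x y i j huw
    · exact hasConflictFreeGeodesic_side_even hnae d x i (j := 7) (by omega)
    · exact hasConflictFreeGeodesic_side_even hnae c₀ x i (by omega)
  · rcases w.cases_side_even c with ⟨w, rfl⟩ | ⟨y, j, rfl⟩ | ⟨d, rfl⟩ | ⟨j, rfl⟩
    · exact (var_any w _ huw.symm).symm
    · exact (hasConflictFreeGeodesic_side_even hnae c y j (j := 7) (by omega)).symm
    · exact hasConflictFreeGeodesic_cls_cls b fun h => huw (h ▸ rfl)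
    · exact hasConflictFreeGeodesic_even_even_of_lt hnae c (i := 7) (by omega) (by omega) (by omega)
  · rcases w.cases_side_even c₀ with ⟨w, rfl⟩ | ⟨y, j, rfl⟩ | ⟨d, rfl⟩ | ⟨j, rfl⟩
    · exact (var_any w _ huw.symm).symm
    · exact (hasConflictFreeGeodesic_side_even hnae c₀ y j (by omega)).symm
    · rw [GV.even_val, ← GV.even_val d]
      exact hasConflictFreeGeodesic_even_even_of_lt hnae d (j := 7) (by omega) (by omega) (by omega)
    · exact hasConflictFreeGeodesic_even_even_of_lt hnae c₀ (by omega) (by omega)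
        fun h => huw (by rw [h])
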